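/- arXiv:math/0403057 — 12 statements merged into one kernel-verified Lean document; each statement's English description precedes it below -/
import Mathlib

section
/- Let S be a conical refinement commutative monoid, let n ≥ 1, and let S₀, …, S_{n−1} be nonempty subsets of S that are pairwise orthogonal (s ⊥ t whenever s ∈ S_i, t ∈ S_j and i ≠ j) and such that every element of S can be written as a sum Σ_{i<n} x_i with x_i ∈ S_i for all i. Then: (1) for each i, S_i equals the set of all s ∈ S that are orthogonal to every element of the form Σ_{j≠i} t_j with t_j ∈ S_j for all j ≠ i; in particular each S_i is an ideal of S; (2) for every x ∈ S there is exactly one tuple (x₀, …, x_{n−1}) with x_i ∈ S_i for all i and x = Σ_{i<n} x_i. -/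
namespace PaperCDS

variable {M : Type*} [AddCommMonoid M]

/-- The algebraic preorder: `a ≤ b` iff `a + c = b` for some `c`. -/
def algLe (a b : M) : Prop := ∃ c : M, a + c = b

/-- `S` is conical if `a + b = 0` implies `a = 0` and `b = 0`. -/
def Conical (M : Type*) [AddCommMonoid M] : Prop :=
  ∀ a b : M, a + b = 0 → a = 0 ∧ b = 0

/-- The refinement property. -/
def Refinement (M : Type*) [AddCommMonoid M] : Prop :=
  ∀ a₀ a₁ b₀ b₁ : M, a₀ + a₁ = b₀ + b₁ →
    ∃ c₀₀ c₀₁ c₁₀ c₁₁ : M,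
      a₀ = c₀₀ + c₀₁ ∧ a₁ = c₁₀ + c₁₁ ∧ b₀ = c₀₀ + c₁₀ ∧ b₁ = c₀₁ + c₁₁

/-- Orthogonality: `a ⊥ b` iff the only `x` with `x ≤ a` and `x ≤ b` is `0`. -/
def Orth (a b : M) : Prop := ∀ x : M, algLe x a → algLe x b → x = 0

/-- `X^⊥ = {s : s ⊥ x for all x ∈ X}`. -/
def perpSet (X : Set M) : Set M := {s : M | ∀ x ∈ X, Orth s x}

/-- An ideal: a nonempty subset `I` with `a + b ∈ I ↔ a ∈ I ∧ b ∈ I`. -/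
def IsIdeal (I : Set M) : Prop :=
  I.Nonempty ∧ ∀ a b : M, a + b ∈ I ↔ a ∈ I ∧ b ∈ I

/-- An additive endomorphism. -/
def IsAddEndo (p : M → M) : Prop :=
  p 0 = 0 ∧ ∀ x y : M, p (x + y) = p x + p y

/-- A projection: an additive endomorphism `p` such that every `x` can be written
`x = p x + y` with `y` orthogonal to every element of the range of `p`. -/
def IsProjection (p : M → M) : Prop :=
  IsAddEndo p ∧ ∀ x : M, ∃ y : M, x = p x + y ∧ ∀ s : M, Orth y (p s)

/-- A complementary pair of projections. -/
def ComplPair (p q : M → M) : Prop :=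
  IsAddEndo p ∧ IsAddEndo q ∧
    ∀ x : M, p x + q x = x ∧ p (q x) = 0 ∧ q (p x) = 0

/-- General comparability. -/
def GenComp (M : Type*) [AddCommMonoid M] : Prop :=
  ∀ a b : M, ∃ p q : M → M, ComplPair p q ∧ algLe (p a) (p b) ∧ algLe (q b) (q a)

/-- `S` is Boolean-valued. -/
def BoolValued (M : Type*) [AddCommMonoid M] : Prop :=
  ∀ a b : M, ∃ p q : M → M, ComplPair p q ∧ algLe (p a) (p b) ∧
    ∀ p' q' : M → M, ComplPair p' q' → algLe (p' a) (p' b) →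
      ∀ x : M, algLe (p' x) (p x)

/-- Directly finite element. -/
def DirectlyFinite (c : M) : Prop := ∀ x : M, x + c = c → x = 0

/-- Purely infinite element. -/
def PurelyInfinite (c : M) : Prop := c + c = c

/-- `b` is an infimum of `X` for the algebraic preorder. -/
def IsInfOf (b : M) (X : Set M) : Prop :=
  (∀ x ∈ X, algLe b x) ∧ ∀ y : M, (∀ x ∈ X, algLe y x) → algLe y b

/-- `b` is a supremum of `X` for the algebraic preorder. -/
def IsSupOf (b : M) (X : Set M) : Prop :=
  (∀ x ∈ X, algLe x b) ∧ ∀ y : M, (∀ x ∈ X, algLe x y) → algLe b y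

/-- Antisymmetry of the algebraic preorder. -/
def Antisymm (M : Type*) [AddCommMonoid M] : Prop :=
  ∀ a b : M, algLe a b → algLe b a → a = b

/-- Axiom (M5): every element is the sum of a directly finite element and a
purely infinite element. -/
def AxiomM5 (M : Type*) [AddCommMonoid M] : Prop :=
  ∀ a : M, ∃ x y : M, DirectlyFinite x ∧ PurelyInfinite y ∧ a = x + y

/-- Axiom (M2): every nonempty subset has an infimum. -/
def AxiomM2 (M : Type*) [AddCommMonoid M] : Prop :=
  ∀ X : Set M, X.Nonempty → ∃ b : M, IsInfOf b X

theorem algLe.trans {a b c : M} (hab : algLe a b) (hbc : algLe b c) : algLe a c := by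
  obtain ⟨u, rfl⟩ := hab
  obtain ⟨v, rfl⟩ := hbc
  exact ⟨u + v, (add_assoc a u v).symm⟩

theorem algLe_add_right (a b : M) : algLe a (a + b) := ⟨b, rfl⟩

theorem algLe_add_left (a b : M) : algLe b (a + b) := ⟨a, add_comm b a⟩

theorem algLe_refl (a : M) : algLe a a := ⟨0, add_zero a⟩

theorem Orth.symm {a b : M} (h : Orth a b) : Orth b a := fun x hb ha => h x ha hb

theorem Orth.mono_left {a b c : M} (h : Orth b c) (hab : algLe a b) : Orth a c :=
  fun x hxa hxc => h x (hxa.trans hab) hxc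

theorem orth_zero_right (hCon : Conical M) (a : M) : Orth a 0 :=
  fun _ _ ⟨y, hy⟩ => (hCon _ y hy).1

/-- In a refinement monoid, orthogonality to an element is preserved by sums. -/
theorem Orth.add_right (hRef : Refinement M) {s a b : M} (ha : Orth s a) (hb : Orth s b) :
    Orth s (a + b) := by
  rintro x hxs ⟨y, hxy⟩
  obtain ⟨u, v, u', v', rfl, -, rfl, rfl⟩ := hRef x y a b hxy
  rw [ha u ((algLe_add_right u v).trans hxs) (algLe_add_right u u'),
    hb v ((algLe_add_left u v).trans hxs) (algLe_add_right v v'), add_zero]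

theorem Orth.sum_right (hCon : Conical M) (hRef : Refinement M) {ι : Type*} {s : M}
    (I : Finset ι) (t : ι → M) (h : ∀ j ∈ I, Orth s (t j)) : Orth s (∑ j ∈ I, t j) :=
  Finset.sum_induction t (Orth s) (fun _ _ => Orth.add_right hRef) (orth_zero_right hCon s) h

/-- Cancellation of orthogonal complements in a refinement monoid. -/
theorem eq_of_add_eq_add_of_orth (hRef : Refinement M) {a b c d : M} (h : a + b = c + d)
    (had : Orth a d) (hbc : Orth b c) : a = c := by
  obtain ⟨u, v, w, z, rfl, rfl, rfl, rfl⟩ := hRef a b c d h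
  rw [had v (algLe_add_left u v) (algLe_add_right v z),
    hbc w (algLe_add_right w z) (algLe_add_left u w)]

/-- In a refinement monoid, the orthogonal of any set is an ideal. -/
theorem isIdeal_perpSet (hCon : Conical M) (hRef : Refinement M) (X : Set M) :
    IsIdeal (perpSet X) := by
  refine ⟨⟨0, fun x _ => (orth_zero_right hCon x).symm⟩, fun a b => ⟨fun h => ⟨?_, ?_⟩, ?_⟩⟩
  · exact fun x hx => (h x hx).mono_left (algLe_add_right a b)
  · exact fun x hx => (h x hx).mono_left (algLe_add_left a b)
  · exact fun h x hx => (Orth.add_right hRef (h.1 x hx).symm (h.2 x hx).symm).symm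

theorem statement0 (hCon : Conical M) (hRef : Refinement M)
    (n : ℕ) (hn : 1 ≤ n) (S : Fin n → Set M)
    (hne : ∀ i, (S i).Nonempty)
    (horth : ∀ i j : Fin n, i ≠ j → ∀ s ∈ S i, ∀ t ∈ S j, Orth s t)
    (hdec : ∀ x : M, ∃ f : Fin n → M, (∀ i, f i ∈ S i) ∧ x = ∑ i, f i) :
    (∀ i : Fin n,
        S i = {s : M | ∀ t : Fin n → M, (∀ j : Fin n, j ≠ i → t j ∈ S j) →
                  Orth s (∑ j ∈ Finset.univ.erase i, t j)} ∧
        IsIdeal (S i)) ∧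
    (∀ x : M, ∃! f : Fin n → M, (∀ i, f i ∈ S i) ∧ x = ∑ i, f i) := by
  have orth_sum (i : Fin n) (s : M) (hs : s ∈ S i) (t : Fin n → M)
      (ht : ∀ j, j ≠ i → t j ∈ S j) : Orth s (∑ j ∈ Finset.univ.erase i, t j) :=
    Orth.sum_right hCon hRef _ t fun j hj =>
      have hji := Finset.ne_of_mem_erase hj
      horth i j hji.symm s hs (t j) (ht j hji)
  have eq_perp (i : Fin n) :
      S i = {s : M | ∀ t : Fin n → M, (∀ j : Fin n, j ≠ i → t j ∈ S j) →
        Orth s (∑ j ∈ Finset.univ.erase i, t j)} := by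
    refine Set.Subset.antisymm (orth_sum i) fun s hs => ?_
    obtain ⟨f, hf, rfl⟩ := hdec s
    have hsplit := Finset.add_sum_erase Finset.univ f (Finset.mem_univ i)
    have hzero := hs f (fun j _ => hf j) _ ⟨f i, (add_comm _ _).trans hsplit⟩ (algLe_refl _)
    rw [← hsplit, hzero, add_zero]
    exact hf i
  refine ⟨fun i => ⟨eq_perp i, ?_⟩, fun x => ?_⟩
  · have hperp : S i = perpSet {x | ∃ t : Fin n → M, (∀ j, j ≠ i → t j ∈ S j) ∧
        ∑ j ∈ Finset.univ.erase i, t j = x} := by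
      rw [eq_perp i]
      ext s
      simp [perpSet]
    rw [hperp]
    exact isIdeal_perpSet hCon hRef _
  · obtain ⟨f, hf, rfl⟩ := hdec x
    refine ⟨f, ⟨hf, rfl⟩, fun g ⟨hg, hfg⟩ => funext fun i => ?_⟩
    rw [← Finset.add_sum_erase _ f (Finset.mem_univ i),
      ← Finset.add_sum_erase _ g (Finset.mem_univ i)] at hfg
    exact eq_of_add_eq_add_of_orth hRef hfg.symm (orth_sum i _ (hg i) f fun j _ => hf j)
      (orth_sum i _ (hf i) g fun j _ => hg j).symm

end PaperCDS
end

section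
/- Let S be a conical refinement commutative monoid and let p be an additive endomorphism of S. Then p is a projection of S if and only if there exist ideals S₀ and S₁ of S such that: every element of S₀ is orthogonal to every element of S₁; every element of S can be written as x₀ + x₁ with x₀ ∈ S₀ and x₁ ∈ S₁; and p(x₀ + x₁) = x₀ for all x₀ ∈ S₀ and x₁ ∈ S₁. -/
namespace PaperCDS

variable {M : Type*} [AddCommMonoid M]

theorem statement1 (hCon : Conical M) (hRef : Refinement M)
    (p : M → M) (hp : IsAddEndo p) :
    IsProjection p ↔
      ∃ S₀ S₁ : Set M, IsIdeal S₀ ∧ IsIdeal S₁ ∧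
        (∀ a ∈ S₀, ∀ b ∈ S₁, Orth a b) ∧
        (∀ x : M, ∃ x₀ ∈ S₀, ∃ x₁ ∈ S₁, x = x₀ + x₁) ∧
        (∀ x₀ ∈ S₀, ∀ x₁ ∈ S₁, p (x₀ + x₁) = x₀) := by
  constructor
  · rintro ⟨-, hproj⟩
    refine ⟨perpSet (perpSet (Set.range p)), perpSet (Set.range p),
      isIdeal_perpSet hCon hRef _, isIdeal_perpSet hCon hRef _, fun a ha b hb => ha b hb,
      fun x => ?_, fun x₀ h₀ x₁ h₁ => ?_⟩
    · obtain ⟨y, hxy, hy⟩ := hproj x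
      refine ⟨p x, fun z hz => (hz (p x) ⟨x, rfl⟩).symm, y, ?_, hxy⟩
      rintro _ ⟨s, rfl⟩
      exact hy s
    · have hp₁ : p x₁ = 0 := by
        obtain ⟨y, hxy, -⟩ := hproj x₁
        exact h₁ (p x₁) ⟨x₁, rfl⟩ (p x₁) ⟨y, hxy.symm⟩ (algLe_refl _)
      obtain ⟨y, hxy, hy⟩ := hproj x₀
      have hy_perp : y ∈ perpSet (Set.range p) := by
        rintro _ ⟨s, rfl⟩
        exact hy s
      have hy₀ : y = 0 :=
        h₀ y hy_perp y ⟨p x₀, by rw [add_comm, ← hxy]⟩ (algLe_refl y)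
      rw [hp.2, hp₁, add_zero]
      rw [hy₀, add_zero] at hxy
      exact hxy.symm
  · rintro ⟨S₀, S₁, -, -, horth, hdecomp, hpS⟩
    refine ⟨hp, fun x => ?_⟩
    obtain ⟨x₀, h₀, x₁, h₁, rfl⟩ := hdecomp x
    refine ⟨x₁, by rw [hpS x₀ h₀ x₁ h₁], fun s => ?_⟩
    obtain ⟨s₀, k₀, s₁, k₁, rfl⟩ := hdecomp s
    rw [hpS s₀ k₀ s₁ k₁]
    exact (horth s₀ k₀ x₁ h₁).symm

end PaperCDS
end

section
/- Let S be a conical refinement commutative monoid and let p, q be projections of S. Then p ∘ q = q ∘ p, and p ∘ q is a projection of S whose range is (range p) ∩ (range q). -/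
namespace PaperCDS

variable {M : Type*} [AddCommMonoid M]

theorem Conical.eq_zero_of_algLe (hCon : Conical M) {a b : M} (h : algLe a b) (hb : b = 0) :
    a = 0 := by
  obtain ⟨c, rfl⟩ := h
  exact (hCon a c hb).1

theorem IsAddEndo.map_algLe {p : M → M} (hp : IsAddEndo p) {a b : M} (h : algLe a b) :
    algLe (p a) (p b) := by
  obtain ⟨c, rfl⟩ := h
  exact ⟨p c, (hp.2 a c).symm⟩

namespace IsProjection

variable {p q : M → M}

theorem algLe_self (hp : IsProjection p) (x : M) : algLe (p x) x := by
  obtain ⟨y, hy, -⟩ := hp.2 x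
  exact ⟨y, hy.symm⟩

theorem exists_ker_add (hp : IsProjection p) (x : M) : ∃ y : M, x = p x + y ∧ p y = 0 := by
  obtain ⟨y, hy, horth⟩ := hp.2 x
  exact ⟨y, hy, horth y _ (hp.algLe_self y) ⟨0, add_zero _⟩⟩

theorem map_eq_self_of_algLe (hp : IsProjection p) {w s : M} (h : algLe w (p s)) : p w = w := by
  obtain ⟨y, hy, horth⟩ := hp.2 w
  obtain ⟨v, hv⟩ := h
  have hy0 : y = 0 :=
    horth s y ⟨0, add_zero y⟩ ⟨p w + v, by rw [← hv, ← add_assoc, add_comm y, ← hy]⟩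
  rw [hy0, add_zero] at hy
  exact hy.symm

theorem map_map_self (hp : IsProjection p) (x : M) : p (p x) = p x :=
  hp.map_eq_self_of_algLe ⟨0, add_zero _⟩

theorem comm_apply (hCon : Conical M) (hp : IsProjection p) (hq : IsProjection q) (x : M) :
    p (q x) = q (p x) := by
  obtain ⟨y, hy, hpy⟩ := hp.exists_ker_add x
  have hpqy : p (q y) = 0 := hCon.eq_zero_of_algLe (hp.1.map_algLe (hq.algLe_self y)) hpy
  calc p (q x) = p (q (p x)) + p (q y) := by rw [← hp.1.2, ← hq.1.2, ← hy]
    _ = q (p x) := by rw [hpqy, add_zero, hp.map_eq_self_of_algLe (hq.algLe_self (p x))]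

theorem comp (hCon : Conical M) (hp : IsProjection p) (hq : IsProjection q) :
    IsProjection (p ∘ q) := by
  have hpq : IsAddEndo (p ∘ q) :=
    ⟨by simp only [Function.comp_apply, hq.1.1, hp.1.1],
      fun x y => by simp only [Function.comp_apply, hq.1.2, hp.1.2]⟩
  refine ⟨hpq, fun x => ?_⟩
  obtain ⟨y, hy, hqy⟩ := hq.exists_ker_add x
  obtain ⟨z, hz, hpz⟩ := hp.exists_ker_add (q x)
  refine ⟨z + y, ?_, fun s w hw hws => ?_⟩
  · rw [Function.comp_apply, ← add_assoc, ← hz, ← hy]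
  · have hpw : p w = w := hp.map_eq_self_of_algLe hws
    have hqw : q w = w :=
      hq.map_eq_self_of_algLe (s := p s) (by rwa [← comm_apply hCon hp hq])
    have hker : (p ∘ q) (z + y) = 0 := by
      rw [hpq.2, Function.comp_apply, Function.comp_apply, comm_apply hCon hp hq z, hpz, hqy,
        hq.1.1, hp.1.1, add_zero]
    have hle := hpq.map_algLe hw
    rw [Function.comp_apply, hqw, hpw] at hle
    exact hCon.eq_zero_of_algLe hle hker

theorem range_comp (hCon : Conical M) (hp : IsProjection p) (hq : IsProjection q) :
    Set.range (p ∘ q) = Set.range p ∩ Set.range q := by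
  ext w
  constructor
  · rintro ⟨x, rfl⟩
    exact ⟨⟨q x, rfl⟩, ⟨p x, (comm_apply hCon hp hq x).symm⟩⟩
  · rintro ⟨⟨a, rfl⟩, ⟨b, hb⟩⟩
    exact ⟨p a, by rw [Function.comp_apply, ← hb, hq.map_map_self, hb, hp.map_map_self]⟩

end IsProjection

theorem statement2 (hCon : Conical M) (hRef : Refinement M)
    (p q : M → M) (hp : IsProjection p) (hq : IsProjection q) :
    (∀ x : M, p (q x) = q (p x)) ∧
    IsProjection (p ∘ q) ∧
    Set.range (p ∘ q) = Set.range p ∩ Set.range q :=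
  ⟨hp.comm_apply hCon hq, hp.comp hCon hq, hp.range_comp hCon hq⟩

end PaperCDS
end

section
/- Let S be a conical refinement commutative monoid satisfying: (N1) for all a, b ∈ S there exist c, x, y ∈ S with a = c + x, b = c + y, and x ⊥ y; and (N2) for every a ∈ S, every element of S can be written as u + v with u ∈ {a}^⊥ and v ∈ {a}^⊥⊥. Then S has general comparability. -/
namespace PaperCDS

variable {M : Type*} [AddCommMonoid M]

theorem zero_mem_perpSet (hCon : Conical M) (X : Set M) : (0 : M) ∈ perpSet X :=
  fun _ _ z ⟨w, hw⟩ _ => (hCon z w hw).1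

theorem add_mem_perpSet (hRef : Refinement M) {X : Set M} {s t : M}
    (hs : s ∈ perpSet X) (ht : t ∈ perpSet X) : s + t ∈ perpSet X := by
  rintro x hx z ⟨w, hw⟩ hzx
  obtain ⟨c, d, e, f, rfl, -, rfl, rfl⟩ := hRef z w s t hw
  rw [hs x hx c (algLe_add_right c e) ((algLe_add_right c d).trans hzx),
    ht x hx d (algLe_add_right d f) ((algLe_add_left c d).trans hzx), add_zero]

theorem self_mem_perpSet_perpSet (a : M) : a ∈ perpSet (perpSet ({a} : Set M)) :=
  fun _ hx z hza hzx => hx a rfl z hzx hza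

/-- Decompositions along `X` and `X^⊥` are unique in a refinement monoid. -/
theorem perpSet_decomposition_unique (hRef : Refinement M) {X : Set M} {u u' v v' : M}
    (hu : u ∈ X) (hu' : u' ∈ X) (hv : v ∈ perpSet X) (hv' : v' ∈ perpSet X)
    (h : u + v = u' + v') : u = u' ∧ v = v' := by
  obtain ⟨c, d, e, f, rfl, rfl, rfl, rfl⟩ := hRef u v u' v' h
  obtain rfl : d = 0 := hv' _ hu d (algLe_add_right d f) (algLe_add_left c d)
  obtain rfl : e = 0 := hv _ hu' e (algLe_add_right e f) (algLe_add_left c e)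
  exact ⟨rfl, rfl⟩

/-- If every element decomposes along `{a}^⊥` and `{a}^⊥⊥`, the two components form a
complementary pair of projections. -/
theorem exists_complPair_perpSet (hCon : Conical M) (hRef : Refinement M) (a : M)
    (h : ∀ z : M, ∃ u ∈ perpSet ({a} : Set M),
      ∃ v ∈ perpSet (perpSet ({a} : Set M)), z = u + v) :
    ∃ p q : M → M, ComplPair p q ∧ (∀ z ∈ perpSet ({a} : Set M), p z = 0) ∧
      ∀ z ∈ perpSet (perpSet ({a} : Set M)), q z = 0 := by
  choose q hq p hp hqp using h
  have unique : ∀ {z u v : M}, u ∈ perpSet ({a} : Set M) →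
      v ∈ perpSet (perpSet ({a} : Set M)) → z = u + v → q z = u ∧ p z = v :=
    fun {z _ _} hu hv hz =>
      perpSet_decomposition_unique hRef (hq z) hu (hp z) hv ((hqp z).symm.trans hz)
  have hp0 : ∀ z ∈ perpSet ({a} : Set M), p z = 0 := fun z hz =>
    (unique hz (zero_mem_perpSet hCon _) (add_zero z).symm).2
  have hq0 : ∀ z ∈ perpSet (perpSet ({a} : Set M)), q z = 0 := fun z hz =>
    (unique (zero_mem_perpSet hCon _) hz (zero_add z).symm).1
  have hadd (x y : M) : q (x + y) = q x + q y ∧ p (x + y) = p x + p y :=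
    unique (add_mem_perpSet hRef (hq x) (hq y)) (add_mem_perpSet hRef (hp x) (hp y)) <| by
      rw [add_add_add_comm, ← hqp, ← hqp]
  exact ⟨p, q, ⟨⟨hp0 0 (zero_mem_perpSet hCon _), fun x y => (hadd x y).2⟩,
    ⟨hq0 0 (zero_mem_perpSet hCon _), fun x y => (hadd x y).1⟩,
    fun x => ⟨(add_comm _ _).trans (hqp x).symm, hp0 _ (hq x), hq0 _ (hp x)⟩⟩, hp0, hq0⟩

theorem statement4 (hCon : Conical M) (hRef : Refinement M)
    (hN1 : ∀ a b : M, ∃ c x y : M, a = c + x ∧ b = c + y ∧ Orth x y)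
    (hN2 : ∀ a z : M, ∃ u ∈ perpSet ({a} : Set M),
      ∃ v ∈ perpSet (perpSet ({a} : Set M)), z = u + v) :
    GenComp M := by
  intro a b
  obtain ⟨c, x, y, rfl, rfl, hxy⟩ := hN1 a b
  obtain ⟨p, q, hpq, hp, hq⟩ := exists_complPair_perpSet hCon hRef y (hN2 y)
  refine ⟨p, q, hpq, ?_, ?_⟩
  · rw [hpq.1.2, hpq.1.2, hp x (by rintro _ rfl; exact hxy), add_zero]
    exact algLe_add_right _ _
  · rw [hpq.2.1.2, hpq.2.1.2, hq y (self_mem_perpSet_perpSet y), add_zero]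
    exact algLe_add_right _ _

end PaperCDS
end

section
/- Let S be a conical refinement commutative monoid with general comparability. Then S satisfies the pseudo-cancellation property: whenever a, b, c ∈ S satisfy a + c = b + c, there exist d, u, v ∈ S with u + c = c, v + c = c, a = d + u, and b = d + v. -/
namespace PaperCDS

variable {M : Type*} [AddCommMonoid M]

theorem statement5 (hCon : Conical M) (hRef : Refinement M) (hGC : GenComp M) :
    ∀ a b c : M, a + c = b + c →
      ∃ d u v : M, u + c = c ∧ v + c = c ∧ a = d + u ∧ b = d + v := by
  intro a b c h
  obtain ⟨d, a₁, c₁, c₂, ha, hc, hb, hc'⟩ := hRef a c b c h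
  obtain ⟨p, q, ⟨⟨-, hp⟩, ⟨-, hq⟩, hpq⟩, ⟨x, hx⟩, ⟨y, hy⟩⟩ := hGC a₁ c₁
  have hxc : x + p c = p c := by
    calc x + p c = x + p (a₁ + c₂) := by rw [← hc']
      _ = (p a₁ + x) + p c₂ := by rw [hp]; abel
      _ = p c := by rw [hx, ← hp, ← hc]
  have hyc : y + q c = q c := by
    calc y + q c = y + q (c₁ + c₂) := by rw [← hc]
      _ = (q c₁ + y) + q c₂ := by rw [hq]; abel
      _ = q c := by rw [hy, ← hq, ← hc']
  refine ⟨d + p a₁ + q c₁, y, x, ?_, ?_, ?_, ?_⟩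
  · calc y + c = p c + (y + q c) := by nth_rw 1 [← (hpq c).1]; abel
      _ = c := by rw [hyc, (hpq c).1]
  · calc x + c = (x + p c) + q c := by nth_rw 1 [← (hpq c).1]; abel
      _ = c := by rw [hxc, (hpq c).1]
  · rw [ha, add_assoc, hy, add_assoc, (hpq a₁).1]
  · calc b = d + (p c₁ + q c₁) := by rw [hb, (hpq c₁).1]
      _ = d + p a₁ + q c₁ + x := by rw [← hx]; abel

end PaperCDS
end

section
/- Let S be a conical refinement commutative monoid with general comparability. Then S is separative: for all a, b, c ∈ S, if a + c = b + c, c ≤ a, and c ≤ b, then a = b. -/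
namespace PaperCDS

variable {M : Type*} [AddCommMonoid M]

/-- An additive endomorphism `f` with `f u ≤ f v` identifies `d + u` and `d + v`, provided that
`u + e = v + e ≤ d + u`. -/
theorem IsAddEndo.map_add_eq_of_algLe {f : M → M} (hf : IsAddEndo f) {d e u v : M}
    (hc : u + e = v + e) (hle : algLe (u + e) (d + u)) (huv : algLe (f u) (f v)) :
    f (d + u) = f (d + v) := by
  obtain ⟨x, hx⟩ := huv
  obtain ⟨y, hy⟩ := hle
  have habs : f (u + e) + x = f (u + e) := by
    conv_rhs => rw [hc, hf.2, ← hx]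
    rw [hf.2]
    abel
  calc f (d + u) = f (u + e) + f y := by rw [← hy, hf.2]
    _ = (f (u + e) + x) + f y := by rw [habs]
    _ = f (d + u) + x := by rw [← hy, hf.2 (u + e)]; abel
    _ = f (d + v) := by rw [hf.2 d v, ← hx, hf.2, add_assoc]

theorem statement6 (hCon : Conical M) (hRef : Refinement M) (hGC : GenComp M) :
    ∀ a b c : M, a + c = b + c → algLe c a → algLe c b → a = b := by
  intro a b c h hca hcb
  obtain ⟨d, u, v, e, rfl, hve, rfl, hue⟩ := hRef a c b c h
  obtain ⟨p, q, ⟨hp, hq, hpq⟩, hpuv, hqvu⟩ := hGC u v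
  have hP := hp.map_add_eq_of_algLe (hue.symm.trans hve) (hue ▸ hca) hpuv
  have hQ := hq.map_add_eq_of_algLe (hve.symm.trans hue) (hve ▸ hcb) hqvu
  rw [← (hpq (d + u)).1, ← (hpq (d + v)).1, hP, hQ]

end PaperCDS
end

section
/- Let S be a conical refinement commutative monoid with general comparability and let c ∈ S be directly finite. Then c is cancellable: for all a, b ∈ S, a + c = b + c implies a = b. -/
namespace PaperCDS

variable {M : Type*} [AddCommMonoid M]

/-- If `p a ≤ p b`, where `p` is additive and `p x + q x = x`, and `a + d = b + d` is directly
finite, then `p a = p b`. -/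
theorem DirectlyFinite.eq_of_algLe {p q : M → M} (hp : IsAddEndo p)
    (hpq : ∀ x, p x + q x = x) {a b d : M} (hfin : DirectlyFinite (a + d))
    (h : a + d = b + d) (hle : algLe (p a) (p b)) : p a = p b := by
  obtain ⟨z, hz⟩ := hle
  have hpz : z + p (a + d) = p (a + d) := by
    calc z + p (a + d) = p a + z + p d := by rw [hp.2]; abel
      _ = p (a + d) := by rw [hz, ← hp.2, h]
  have hz0 : z = 0 := hfin z <| by
    calc z + (a + d) = z + p (a + d) + q (a + d) := by rw [add_assoc, hpq]
      _ = a + d := by rw [hpz, hpq]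
  rw [← hz, hz0, add_zero]

theorem statement7 (hCon : Conical M) (hRef : Refinement M) (hGC : GenComp M)
    (c : M) (hc : DirectlyFinite c) :
    ∀ a b : M, a + c = b + c → a = b := by
  intro a b h
  obtain ⟨e, a', b', d, rfl, hb, rfl, ha⟩ := hRef a c b c h
  obtain ⟨p, q, ⟨hp, hq, hpq⟩, hple, hqle⟩ := hGC a' b'
  have hpa : p a' = p b' :=
    (ha ▸ hc).eq_of_algLe hp (fun x => (hpq x).1) (ha.symm.trans hb) hple
  have hqa : q b' = q a' :=
    (hb ▸ hc).eq_of_algLe hq (fun x => (add_comm _ _).trans (hpq x).1) (hb.symm.trans ha) hqle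
  rw [← (hpq a').1, ← (hpq b').1, hpa, hqa]

end PaperCDS
end

section
/- Let S be a conical refinement commutative monoid, let p be a projection of S, let (a_i)_{i∈I} be a family of elements of S, and let a ∈ S. Then: (1) if I is nonempty and a is an infimum of {a_i : i ∈ I} with respect to the algebraic preorder, then p(a) is an infimum of {p(a_i) : i ∈ I}; (2) if every pair of elements of S has an infimum, and a is a supremum of {a_i : i ∈ I}, then p(a) is a supremum of {p(a_i) : i ∈ I}. -/
namespace PaperCDS

variable {M : Type*} [AddCommMonoid M]

theorem algLe.add {a b c d : M} (hab : algLe a b) (hcd : algLe c d) :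
    algLe (a + c) (b + d) := by
  obtain ⟨u, rfl⟩ := hab
  obtain ⟨v, rfl⟩ := hcd
  exact ⟨u + v, add_add_add_comm a c u v⟩

theorem IsAddEndo.algLe_map {p : M → M} (hp : IsAddEndo p) {a b : M} (hab : algLe a b) :
    algLe (p a) (p b) := by
  obtain ⟨c, rfl⟩ := hab
  exact ⟨p c, (hp.2 a c).symm⟩

theorem IsProjection.apply_algLe {p : M → M} (hp : IsProjection p) (x : M) :
    algLe (p x) x := by
  obtain ⟨y, hy, -⟩ := hp.2 x
  exact ⟨y, hy.symm⟩

/-- A projection kills every element orthogonal to its range. -/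
theorem IsProjection.apply_eq_zero {p : M → M} (hp : IsProjection p) {y : M}
    (hy : ∀ s : M, Orth y (p s)) : p y = 0 :=
  hy y (p y) (hp.apply_algLe y) ⟨0, add_zero _⟩

theorem IsProjection.apply_apply {p : M → M} (hp : IsProjection p) (x : M) :
    p (p x) = p x := by
  obtain ⟨y, hxy, hy⟩ := hp.2 x
  have h := hp.1.2 (p x) y
  rw [← hxy, hp.apply_eq_zero hy, add_zero] at h
  exact h.symm

/-- The range of a projection is closed under taking smaller elements. -/
theorem IsProjection.apply_eq_of_algLe {p : M → M} (hp : IsProjection p) {x s : M}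
    (hx : algLe x (p s)) : p x = x := by
  obtain ⟨y, hxy, hy⟩ := hp.2 x
  have hyx : algLe y x := ⟨p x, by rw [add_comm, ← hxy]⟩
  have hy0 : y = 0 := hy s y ⟨0, add_zero y⟩ (hyx.trans hx)
  rw [hy0, add_zero] at hxy
  exact hxy.symm

/-- In a refinement monoid, an element below a sum and orthogonal to the first summand
is below the second one. -/
theorem Refinement.algLe_of_orth (hRef : Refinement M) {x a b : M}
    (hx : algLe x (a + b)) (hxa : Orth x a) : algLe x b := by
  obtain ⟨c, hc⟩ := hx
  obtain ⟨u, v, w, z, rfl, -, rfl, rfl⟩ := hRef x c a b hc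
  have hu : u = 0 := hxa u ⟨v, rfl⟩ ⟨w, rfl⟩
  exact ⟨z, by rw [hu, zero_add]⟩

theorem IsProjection.isInfOf_range {p : M → M} (hp : IsProjection p) {I : Type*} [Nonempty I]
    {a : I → M} {b : M} (hb : IsInfOf b (Set.range a)) :
    IsInfOf (p b) (Set.range fun i => p (a i)) := by
  refine ⟨?_, fun y hy => ?_⟩
  · rintro _ ⟨i, rfl⟩
    exact hp.1.algLe_map (hb.1 _ ⟨i, rfl⟩)
  · have hyb : algLe y b := by
      refine hb.2 y ?_
      rintro _ ⟨i, rfl⟩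
      exact (hy _ ⟨i, rfl⟩).trans (hp.apply_algLe (a i))
    have hpy : p y = y := hp.apply_eq_of_algLe (hy _ ⟨Classical.arbitrary I, rfl⟩)
    exact hpy ▸ hp.1.algLe_map hyb

theorem IsProjection.isSupOf_range {p : M → M} (hp : IsProjection p) (hRef : Refinement M)
    {I : Type*} {a : I → M} {b : M} (hb : IsSupOf b (Set.range a)) :
    IsSupOf (p b) (Set.range fun i => p (a i)) := by
  refine ⟨?_, fun y hy => ?_⟩
  · rintro _ ⟨i, rfl⟩
    exact hp.1.algLe_map (hb.1 _ ⟨i, rfl⟩)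
  · obtain ⟨b', hbb', hb'⟩ := hp.2 b
    have hle : algLe b (p y + b') := by
      refine hb.2 _ ?_
      rintro _ ⟨i, rfl⟩
      obtain ⟨c, hac, hc⟩ := hp.2 (a i)
      have hca : algLe c (a i) := ⟨p (a i), by rw [add_comm, ← hac]⟩
      have hcb : algLe c (p b + b') := hbb' ▸ hca.trans (hb.1 _ ⟨i, rfl⟩)
      have hpa : algLe (p (a i)) (p y) := by
        simpa only [hp.apply_apply] using hp.1.algLe_map (hy _ ⟨i, rfl⟩)
      rw [hac]
      exact hpa.add (hRef.algLe_of_orth hcb (hc b))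
    have h := hp.1.algLe_map hle
    rw [hp.1.2, hp.apply_apply, hp.apply_eq_zero hb', add_zero] at h
    exact h.trans (hp.apply_algLe y)

theorem statement8 (hCon : Conical M) (hRef : Refinement M)
    (p : M → M) (hp : IsProjection p)
    {I : Type*} (a : I → M) (b : M) :
    (Nonempty I → IsInfOf b (Set.range a) →
      IsInfOf (p b) (Set.range fun i => p (a i))) ∧
    ((∀ x y : M, ∃ z : M, IsInfOf z {x, y}) → IsSupOf b (Set.range a) →
      IsSupOf (p b) (Set.range fun i => p (a i))) :=
  ⟨fun _ hb => hp.isInfOf_range hb, fun _ hb => hp.isSupOf_range hRef hb⟩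

end PaperCDS
end

section
/- Let S be a conical refinement commutative monoid whose algebraic preorder is antisymmetric, which has general comparability, is Boolean-valued, and in which every element is the sum of a directly finite element and a purely infinite element. Then for all a, b ∈ S with a ≤ b, the largest difference b − a exists: there is c ∈ S with a + c = b and x ≤ c for every x ∈ S with a + x ≤ b. -/
namespace PaperCDS

variable {M : Type*} [AddCommMonoid M]

/-- If `x` is directly finite and the `p`-parts of two complements `e`, `f` of the same
part `g` in `x` are comparable, then these parts agree. -/
theorem DirectlyFinite.map_eq_of_algLe {x e f g : M} {p q : M → M} (hx : DirectlyFinite x)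
    (hp : ∀ u v : M, p (u + v) = p u + p v) (hpq : ∀ u : M, p u + q u = u)
    (he : x = g + e) (hf : x = g + f) (h : algLe (p e) (p f)) : p e = p f := by
  obtain ⟨t, ht⟩ := h
  have hpx : t + p x = p x := by
    conv_rhs => rw [hf, hp, ← ht]
    rw [he, hp]
    abel
  have ht0 : t = 0 := hx t (by rw [← hpq x, ← add_assoc, hpx])
  rw [← ht, ht0, add_zero]

/-- In a refinement monoid with general comparability, directly finite elements cancel. -/
theorem DirectlyFinite.add_left_cancel (hRef : Refinement M) (hGC : GenComp M) {x u v : M}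
    (hx : DirectlyFinite x) (h : x + u = x + v) : u = v := by
  obtain ⟨g, e, f, d, hxe, hu, hxf, hv⟩ := hRef x u x v h
  obtain ⟨p, q, ⟨⟨_, hp⟩, ⟨_, hq⟩, hpq⟩, hle, hge⟩ := hGC e f
  have hpe : p e = p f := hx.map_eq_of_algLe hp (fun z => (hpq z).1) hxe hxf hle
  have hqe : q f = q e :=
    hx.map_eq_of_algLe hq (fun z => (add_comm _ _).trans (hpq z).1) hxf hxe hge
  have hef : e = f := by rw [← (hpq e).1, ← (hpq f).1, hpe, hqe]
  rw [hu, hv, hef]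

theorem statement13 (hCon : Conical M) (hRef : Refinement M)
    (hAnti : Antisymm M) (hGC : GenComp M) (hBV : BoolValued M)
    (hM5 : AxiomM5 M) :
    ∀ a b : M, algLe a b →
      ∃ c : M, a + c = b ∧ ∀ x : M, algLe (a + x) b → algLe x c := by
  rintro a b ⟨c, rfl⟩
  obtain ⟨x, y, hx, hy, rfl⟩ := hM5 a
  have hyc : y + (y + c) = y + c := by rw [← add_assoc, hy]
  refine ⟨y + c, by rw [add_assoc, hyc, add_assoc], ?_⟩
  rintro z ⟨w, hw⟩
  have hcancel : y + z + w = y + c :=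
    hx.add_left_cancel hRef hGC (by simpa only [add_assoc] using hw)
  exact ⟨y + w, by rw [← hcancel]; abel⟩

end PaperCDS
end

section
/- Let Ω be an extremally disconnected topological space, let K be a complete linear order endowed with its order topology, and let f : Ω → K be lower semicontinuous. Define f* : Ω → K by f*(x) = inf over all open neighborhoods V of x of sup of the image f[V] (that is, f*(x) = ⨅_{V open, x ∈ V} ⨆_{y ∈ V} f(y)). Then f* is continuous, f(x) ≤ f*(x) for all x ∈ Ω, and f* is the least continuous function above f: every continuous g : Ω → K with f(x) ≤ g(x) for all x satisfies f*(x) ≤ g(x) for all x. -/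
/-- Two points `a < b` of a linear order are separated by `c > a` and `d < b` such that every point
is `≥ c` or `≤ d`. -/
theorem exists_gt_exists_lt_forall_le_or_le {K : Type*} [LinearOrder K] {a b : K} (h : a < b) :
    ∃ c > a, ∃ d < b, ∀ k, c ≤ k ∨ k ≤ d := by
  obtain ⟨c, hc, d, hd, hcd⟩ := h.exists_disjoint_Iio_Ioi
  refine ⟨c, hc, d, hd, fun k => ?_⟩
  by_contra! hk
  exact lt_irrefl k (hcd k hk.1 k hk.2)

theorem statement17 {Ω : Type*} [TopologicalSpace Ω] [ExtremallyDisconnected Ω]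
    {K : Type*} [CompleteLinearOrder K] [TopologicalSpace K] [OrderTopology K]
    (f : Ω → K) (hf : ∀ α : K, IsClosed {x : Ω | f x ≤ α}) :
    Continuous (fun x : Ω => ⨅ V ∈ {V : Set Ω | IsOpen V ∧ x ∈ V}, ⨆ y ∈ V, f y) ∧
    (∀ x : Ω, f x ≤ ⨅ V ∈ {V : Set Ω | IsOpen V ∧ x ∈ V}, ⨆ y ∈ V, f y) ∧
    (∀ g : Ω → K, Continuous g → (∀ x : Ω, f x ≤ g x) →
      ∀ x : Ω, (⨅ V ∈ {V : Set Ω | IsOpen V ∧ x ∈ V}, ⨆ y ∈ V, f y) ≤ g x) := by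
  have hle {x : Ω} {V : Set Ω} (hV : IsOpen V) (hx : x ∈ V) :
      (⨅ V ∈ {V : Set Ω | IsOpen V ∧ x ∈ V}, ⨆ y ∈ V, f y) ≤ ⨆ y ∈ V, f y :=
    iInf₂_le V ⟨hV, hx⟩
  refine ⟨?_, fun x => le_iInf₂ fun V hV => le_iSup₂ (f := fun y _ => f y) x hV.2, ?_⟩
  · refine OrderTopology.continuous_iff.2 fun a => ⟨?_, ?_⟩
    · refine isOpen_iff_forall_mem_open.2 fun x hx => ?_
      obtain ⟨c, hc, d, hd, hcd⟩ := exists_gt_exists_lt_forall_le_or_le (Set.mem_Ioi.1 hx)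
      have hopen : IsOpen {y | d < f y} := by
        simpa [Set.compl_def] using (hf d).isOpen_compl
      refine ⟨closure {y | d < f y}, fun y hy => ?_,
        ExtremallyDisconnected.open_closure _ hopen, ?_⟩
      · refine lt_of_lt_of_le hc (le_iInf₂ fun V hV => ?_)
        obtain ⟨z, hzV, hz⟩ := mem_closure_iff.1 hy V hV.1 hV.2
        exact ((hcd (f z)).resolve_right (not_le.2 hz)).trans
          (le_iSup₂ (f := fun y _ => f y) z hzV)
      · refine mem_closure_iff.2 fun V hV hxV => ?_
        obtain ⟨z, hzV, hz⟩ : ∃ z, ∃ _ : z ∈ V, d < f z := by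
          simpa only [lt_iSup_iff] using hd.trans_le (hle hV hxV)
        exact ⟨z, hzV, hz⟩
    · refine isOpen_iff_forall_mem_open.2 fun x hx => ?_
      obtain ⟨V, hV, hVa⟩ : ∃ V, ∃ _ : V ∈ {V : Set Ω | IsOpen V ∧ x ∈ V}, (⨆ y ∈ V, f y) < a := by
        simpa only [iInf_lt_iff] using Set.mem_Iio.1 hx
      exact ⟨V, fun y hy => (hle hV.1 hy).trans_lt hVa, hV.1, hV.2⟩
  · intro g hg hfg x
    by_contra! hlt
    obtain ⟨c, hc, d, hd, hcd⟩ := exists_gt_exists_lt_forall_le_or_le hlt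
    refine hd.not_ge ((hle (isOpen_Iio.preimage hg) (Set.mem_preimage.2 hc)).trans
      (iSup₂_le fun y hy => ?_))
    exact (hcd (f y)).resolve_left (not_le.2 ((hfg y).trans_lt hy))
end

section
/- Let X be an extremally disconnected compact Hausdorff space which is hyperstonian: for every nonempty open subset U of X there exists a finite Borel measure μ on X, inner regular with respect to compact sets, vanishing on every closed set with empty interior (hence on every nowhere dense set), such that μ(U) > 0. Then X is locally σ-finite: every nonempty open subset of X contains a nonempty clopen set C such that every family of pairwise disjoint nonempty clopen subsets of C is countable. -/
open MeasureTheory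

/-- For a measure inner regular with respect to compact sets, the union of all null open sets
is null. -/
theorem measure_sUnion_isOpen_null {X : Type*} [TopologicalSpace X] [MeasurableSpace X]
    [OpensMeasurableSpace X] (μ : Measure X)
    (hreg : ∀ s : Set X, MeasurableSet s → ∀ r : ENNReal, r < μ s →
      ∃ K ⊆ s, IsCompact K ∧ r < μ K) :
    μ (⋃₀ {W : Set X | IsOpen W ∧ μ W = 0}) = 0 := by
  by_contra h
  obtain ⟨K, hKs, hK, hpos⟩ :=
    hreg _ (isOpen_sUnion fun W hW => hW.1).measurableSet 0 (pos_iff_ne_zero.mpr h)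
  refine hpos.ne' (hK.measure_zero_of_nhdsWithin fun x hx => ?_)
  obtain ⟨W, ⟨hWo, hW0⟩, hxW⟩ := hKs hx
  exact ⟨W, mem_nhdsWithin_of_mem_nhds (hWo.mem_nhds hxW), hW0⟩

/-- In an extremally disconnected space, if a measure is inner regular with respect to compact
sets and vanishes on closed sets with empty interior, then the union of all null open sets is
clopen. -/
theorem isClopen_sUnion_isOpen_null {X : Type*} [TopologicalSpace X]
    [ExtremallyDisconnected X] [MeasurableSpace X] [OpensMeasurableSpace X] (μ : Measure X)
    (hreg : ∀ s : Set X, MeasurableSet s → ∀ r : ENNReal, r < μ s →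
      ∃ K ⊆ s, IsCompact K ∧ r < μ K)
    (hnull : ∀ F : Set X, IsClosed F → interior F = ∅ → μ F = 0) :
    IsClopen (⋃₀ {W : Set X | IsOpen W ∧ μ W = 0}) := by
  set V := ⋃₀ {W : Set X | IsOpen W ∧ μ W = 0}
  have hVo : IsOpen V := isOpen_sUnion fun W hW => hW.1
  have hcl : μ (closure V) = 0 := by
    rw [closure_eq_self_union_frontier]
    exact measure_union_null (measure_sUnion_isOpen_null μ hreg)
      (hnull _ isClosed_frontier (frontier_compl V ▸ interior_frontier hVo.isClosed_compl))
  have hsub : closure V ⊆ V := Set.subset_sUnion_of_mem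
    ⟨ExtremallyDisconnected.open_closure V hVo, hcl⟩
  exact ⟨closure_subset_iff_isClosed.mp hsub, hVo⟩

theorem statement18 {X : Type*} [TopologicalSpace X] [CompactSpace X] [T2Space X]
    [ExtremallyDisconnected X] [MeasurableSpace X] [BorelSpace X]
    (hyper : ∀ U : Set X, IsOpen U → U.Nonempty →
      ∃ μ : Measure X, IsFiniteMeasure μ ∧
        (∀ s : Set X, MeasurableSet s → ∀ r : ENNReal, r < μ s →
          ∃ K ⊆ s, IsCompact K ∧ r < μ K) ∧
        (∀ F : Set X, IsClosed F → interior F = ∅ → μ F = 0) ∧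
        0 < μ U) :
    ∀ U : Set X, IsOpen U → U.Nonempty →
      ∃ C : Set X, C ⊆ U ∧ IsClopen C ∧ C.Nonempty ∧
        ∀ 𝒟 : Set (Set X), (∀ D ∈ 𝒟, IsClopen D ∧ D.Nonempty ∧ D ⊆ C) →
          𝒟.PairwiseDisjoint id → 𝒟.Countable := by
  intro U hU hUne
  obtain ⟨μ, hfin, hreg, hnull, hpos⟩ := hyper U hU hUne
  set V := ⋃₀ {W : Set X | IsOpen W ∧ μ W = 0}
  have hVc : IsClopen V := isClopen_sUnion_isOpen_null μ hreg hnull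
  obtain ⟨x, hxU, hxV⟩ : (U \ V).Nonempty := by
    rw [Set.sdiff_nonempty]
    exact fun h => hpos.ne' (measure_mono_null h (measure_sUnion_isOpen_null μ hreg))
  obtain ⟨C, hC, hxC, hCsub⟩ :=
    compact_exists_isClopen_in_isOpen (hU.sdiff hVc.isClosed) ⟨hxU, hxV⟩
  refine ⟨C, fun y hy => (hCsub hy).1, hC, ⟨x, hxC⟩, fun 𝒟 h𝒟 hdisj => ?_⟩
  have hmeas : ∀ D : 𝒟, 0 < μ D.1 := by
    rintro ⟨D, hD⟩
    obtain ⟨hDc, ⟨y, hy⟩, hDC⟩ := h𝒟 D hD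
    exact pos_iff_ne_zero.mpr fun h0 =>
      (hCsub (hDC hy)).2 (Set.mem_sUnion_of_mem hy ⟨hDc.isOpen, h0⟩)
  have hcount := Measure.countable_meas_pos_of_disjoint_iUnion (μ := μ) (As := fun D : 𝒟 => D.1)
    (fun D => (h𝒟 D.1 D.2).1.isOpen.measurableSet)
    (fun D E hDE => hdisj D.2 E.2 (Subtype.coe_injective.ne hDE))
  rw [Set.eq_univ_of_forall (s := {D : 𝒟 | 0 < μ D.1}) hmeas] at hcount
  exact Set.countable_coe_iff.mp (Set.countable_univ_iff.mp hcount)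
end

section
/- Let L be a conditionally complete, meet-continuous, sectionally complemented, modular lattice with least element ⊥. Let (a_i)_{i∈I} and (b_j)_{j∈J} be orthogonal families in L with sup_{i∈I} a_i = sup_{j∈J} b_j. Then there exist families (x_{i,j})_{(i,j)∈I×J} and (y_{i,j})_{(i,j)∈I×J} of elements of L such that: for every i ∈ I, (x_{i,j})_{j∈J} is an orthogonal family with supremum a_i; for every j ∈ J, (y_{i,j})_{i∈I} is an orthogonal family with supremum b_j; and x_{i,j} ∼₂ y_{i,j} (bi-perspective) for all (i,j) ∈ I × J. -/
namespace PaperEsp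

variable {L : Type*} [Lattice L] [OrderBot L]

/-- Perspectivity: `a ∼ b` iff there is `z` with `a ⊓ z = ⊥`, `b ⊓ z = ⊥`,
and `a ⊔ z = b ⊔ z`. -/
def Persp (a b : L) : Prop :=
  ∃ z : L, a ⊓ z = ⊥ ∧ b ⊓ z = ⊥ ∧ a ⊔ z = b ⊔ z

/-- Bi-perspectivity: `a ∼₂ b` iff `a ∼ c ∼ b` for some `c`. -/
def BiPersp (a b : L) : Prop := ∃ c : L, Persp a c ∧ Persp c b

/-- An orthogonal family : bounded above, and each member is disjoint from the
join of any finite set of the other members. -/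
def OrthFam {I : Type*} (a : I → L) : Prop :=
  BddAbove (Set.range a) ∧ ∀ J : Finset I, ∀ i ∉ J, a i ⊓ J.sup a = ⊥

/-- Meet-continuity, for suprema of nonempty bounded directed sets. -/
def MeetContinuous (L : Type*) [Lattice L] : Prop :=
  ∀ a : L, ∀ D : Set L, D.Nonempty → DirectedOn (· ≤ ·) D → BddAbove D →
    ∀ m : L, IsLUB D m → IsLUB ((fun d => a ⊓ d) '' D) (a ⊓ m)

/-- `x` is a complement of `c` in the interval `[⊥, d]`. -/
def IsComplIn (c d x : L) : Prop :=
  c ⊓ x = ⊥ ∧ c ⊔ x = d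

theorem Persp.symm {a b : L} : Persp a b → Persp b a := by
  rintro ⟨z, h₁, h₂, h₃⟩
  exact ⟨z, h₂, h₁, h₃.symm⟩

/-- In a modular lattice, elements that are disjoint from everything preceding them form an
orthogonal family. -/
theorem OrthFam.of_inf_eq_bot [IsModularLattice L] {J : Type*} [LinearOrder J] {c x : J → L}
    (hbdd : BddAbove (Set.range x)) (hx : ∀ j k, j < k → x j ≤ c k)
    (hcx : ∀ j, c j ⊓ x j = ⊥) : OrthFam x := by
  refine ⟨hbdd, fun F => ?_⟩
  induction F using Finset.induction_on_max with
  | empty => simp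
  | insert n F hn ih =>
    intro i hi
    rw [Finset.mem_insert, not_or] at hi
    rw [Finset.sup_insert]
    rcases lt_or_gt_of_ne hi.1 with h | h
    · have hle : x i ⊔ F.sup x ≤ c n :=
        sup_le (hx i n h) (Finset.sup_le fun k hk => hx k n (hn k hk))
      have hbot : x n ⊓ (x i ⊔ F.sup x) = ⊥ := by
        rw [eq_bot_iff, ← hcx n, inf_comm (c n)]
        exact inf_le_inf_left _ hle
      have heq : (F.sup x ⊔ x n) ⊓ (x i ⊔ F.sup x) = F.sup x := by
        rw [sup_inf_assoc_of_le _ le_sup_right, hbot, sup_bot_eq]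
      rw [eq_bot_iff, ← ih i hi.2]
      refine le_inf inf_le_left (le_trans ?_ heq.le)
      rw [sup_comm (x n)]
      exact le_inf inf_le_right (inf_le_left.trans le_sup_left)
    · have hle : x n ⊔ F.sup x ≤ c i :=
        sup_le (hx n i h) (Finset.sup_le fun k hk => hx k i ((hn k hk).trans h))
      rw [eq_bot_iff, ← hcx i, inf_comm (c i)]
      exact inf_le_inf_left _ hle

/-- Relative complements of the steps of a continuous well-ordered chain form an orthogonal family
with the same supremum as the chain. -/
theorem orthFam_of_chain [IsModularLattice L] {J : Type*} [LinearOrder J] [WellFoundedLT J]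
    {c d x : J → L} {a : L} (hc : ∀ j, IsLUB (d '' Set.Iio j) (c j))
    (ha : IsLUB (Set.range d) a) (hx : ∀ j, IsComplIn (c j) (d j) (x j)) :
    OrthFam x ∧ IsLUB (Set.range x) a := by
  have hxd : ∀ j, x j ≤ d j := fun j => (hx j).2 ▸ le_sup_right
  have hxa : a ∈ upperBounds (Set.range x) := by
    rintro _ ⟨j, rfl⟩
    exact (hxd j).trans (ha.1 ⟨j, rfl⟩)
  refine ⟨.of_inf_eq_bot ⟨a, hxa⟩
    (fun j k hjk => (hxd j).trans ((hc k).1 ⟨j, hjk, rfl⟩)) (fun j => (hx j).1), hxa, ?_⟩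
  intro u hu
  refine ha.2 ?_
  rintro _ ⟨j, rfl⟩
  induction j using WellFoundedLT.induction with
  | ind j ih =>
    rw [← (hx j).2]
    refine sup_le ((hc j).2 ?_) (hu ⟨j, rfl⟩)
    rintro _ ⟨k, hk, rfl⟩
    exact ih k hk

theorem OrthFam.inf_eq_bot (hmc : MeetContinuous L) {I : Type*} {a : I → L} (ha : OrthFam a)
    {s : Set I} {i : I} (hi : i ∉ s) {A : L} (hA : IsLUB (a '' s) A) : a i ⊓ A = ⊥ := by
  classical
  set D : Set L := {u | ∃ F : Finset I, ↑F ⊆ s ∧ F.sup a = u}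
  have hlub : IsLUB D A := by
    constructor
    · rintro _ ⟨F, hF, rfl⟩
      exact Finset.sup_le fun k hk => hA.1 ⟨k, hF hk, rfl⟩
    · intro u hu
      refine hA.2 ?_
      rintro _ ⟨k, hk, rfl⟩
      exact hu ⟨{k}, by simpa using hk, by simp⟩
  have hdir : DirectedOn (· ≤ ·) D := by
    rintro _ ⟨F, hF, rfl⟩ _ ⟨G, hG, rfl⟩
    exact ⟨_, ⟨F ∪ G, by simp [hF, hG], rfl⟩, Finset.sup_mono Finset.subset_union_left,
      Finset.sup_mono Finset.subset_union_right⟩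
  have h := hmc (a i) D ⟨_, ∅, by simp, rfl⟩ hdir ⟨A, hlub.1⟩ A hlub
  rw [eq_bot_iff]
  refine h.2 ?_
  rintro _ ⟨_, ⟨F, hF, rfl⟩, rfl⟩
  exact (ha.2 F i fun h => hi (hF h)).le

/-- The map sending `u` to the trace on `a` of the Zassenhaus refinement of `[A, A ⊔ a]` by `u`
preserves directed suprema. -/
theorem isLUB_image_refine (hmc : MeetContinuous L) {A a : L} (hAa : a ⊓ A = ⊥) {D : Set L}
    (hD : DirectedOn (· ≤ ·) D) {u : L} (hu : IsLUB D u) :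
    IsLUB ((fun v => a ⊓ (A ⊔ (A ⊔ a) ⊓ v)) '' D) (a ⊓ (A ⊔ (A ⊔ a) ⊓ u)) := by
  rcases D.eq_empty_or_nonempty with rfl | hne
  · rw [isLUB_empty_iff] at hu
    simp [hu.eq_bot, hAa]
  · have h₁ := hmc (A ⊔ a) D hne hD ⟨u, hu.1⟩ u hu
    have h₂ : IsLUB ((fun v => A ⊔ (A ⊔ a) ⊓ v) '' D) (A ⊔ (A ⊔ a) ⊓ u) := by
      constructor
      · rintro _ ⟨v, hv, rfl⟩
        exact sup_le_sup_left (h₁.1 ⟨v, hv, rfl⟩) _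
      · intro w hw
        obtain ⟨v, hv⟩ := hne
        refine sup_le (le_sup_left.trans (hw ⟨v, hv, rfl⟩)) (h₁.2 ?_)
        rintro _ ⟨v, hv, rfl⟩
        exact le_sup_right.trans (hw ⟨v, hv, rfl⟩)
    have hdir : DirectedOn (· ≤ ·) ((fun v => A ⊔ (A ⊔ a) ⊓ v) '' D) := by
      rintro _ ⟨v, hv, rfl⟩ _ ⟨w, hw, rfl⟩
      obtain ⟨t, ht, hvt, hwt⟩ := hD v hv w hw
      exact ⟨_, ⟨t, ht, rfl⟩, sup_le_sup_left (inf_le_inf_left _ hvt) _,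
        sup_le_sup_left (inf_le_inf_left _ hwt) _⟩
    have h₃ := hmc a _ (hne.image _) hdir ⟨_, h₂.1⟩ _ h₂
    rwa [Set.image_image] at h₃

theorem monotone_partialSup {M J : Type*} [Lattice M] [LinearOrder J] {b B : J → M}
    (hB : ∀ j, IsLUB (b '' Set.Iio j) (B j)) : Monotone fun j => B j ⊔ b j := by
  intro j k hjk
  rcases hjk.eq_or_lt with rfl | h
  · exact le_rfl
  · refine le_sup_of_le_left (sup_le ((hB j).2 ?_) ((hB k).1 ⟨j, h, rfl⟩))
    rintro _ ⟨l, hl, rfl⟩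
    exact (hB k).1 ⟨l, lt_trans hl h, rfl⟩

theorem isLUB_partialSup_image {M J : Type*} [Lattice M] [LinearOrder J] {b B : J → M}
    (hB : ∀ j, IsLUB (b '' Set.Iio j) (B j)) {s : Set J} (hs : IsLowerSet s) {u : M}
    (hu : IsLUB (b '' s) u) : IsLUB ((fun j => B j ⊔ b j) '' s) u := by
  constructor
  · rintro _ ⟨j, hj, rfl⟩
    refine sup_le ((hB j).2 ?_) (hu.1 ⟨j, hj, rfl⟩)
    rintro _ ⟨k, hk, rfl⟩
    exact hu.1 ⟨k, hs (le_of_lt hk) hj, rfl⟩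
  · intro v hv
    refine hu.2 ?_
    rintro _ ⟨j, hj, rfl⟩
    exact le_sup_right.trans (hv ⟨j, hj, rfl⟩)

/-- The relative complements of the Zassenhaus refinement of `[A, A ⊔ a]` by the partial suprema
of `b`, pulled back to `[⊥, a]`, form an orthogonal family with supremum `a`. -/
theorem orthFam_refine [IsModularLattice L] (hmc : MeetContinuous L) {J : Type*} [LinearOrder J]
    [WellFoundedLT J] {b B : J → L} (hB : ∀ j, IsLUB (b '' Set.Iio j) (B j)) {m : L}
    (hb : IsLUB (Set.range b) m) {A a : L} (hAa : a ⊓ A = ⊥) (ham : A ⊔ a ≤ m) {x : J → L}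
    (hx : ∀ j, IsComplIn (a ⊓ (A ⊔ (A ⊔ a) ⊓ B j)) (a ⊓ (A ⊔ (A ⊔ a) ⊓ (B j ⊔ b j))) (x j)) :
    OrthFam x ∧ IsLUB (Set.range x) a := by
  have key : ∀ (s : Set J), IsLowerSet s → ∀ u, IsLUB (b '' s) u →
      IsLUB ((fun j => a ⊓ (A ⊔ (A ⊔ a) ⊓ (B j ⊔ b j))) '' s) (a ⊓ (A ⊔ (A ⊔ a) ⊓ u)) := by
    intro s hs u hu
    have hdir : DirectedOn (· ≤ ·) ((fun j => B j ⊔ b j) '' s) := by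
      rintro _ ⟨j, hj, rfl⟩ _ ⟨k, hk, rfl⟩
      rcases le_total j k with h | h
      · exact ⟨_, ⟨k, hk, rfl⟩, monotone_partialSup hB h, le_rfl⟩
      · exact ⟨_, ⟨j, hj, rfl⟩, le_rfl, monotone_partialSup hB h⟩
    have := isLUB_image_refine hmc hAa hdir (isLUB_partialSup_image hB hs hu)
    rwa [Set.image_image] at this
  refine orthFam_of_chain (fun j => key _ (isLowerSet_Iio j) _ (hB j)) ?_ hx
  have h := key Set.univ isLowerSet_univ m (by rwa [Set.image_univ])
  rwa [Set.image_univ, inf_eq_left.2 ham, sup_eq_right.2 (le_sup_left : A ≤ A ⊔ a),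
    inf_eq_left.2 (le_sup_right : a ≤ A ⊔ a)] at h

/-- One half of the Zassenhaus lemma, in terms of perspectivity of relative complements. -/
theorem persp_refine [IsModularLattice L] {A a B E x w : L} (hB : B ≤ E)
    (hx : IsComplIn (a ⊓ (A ⊔ (A ⊔ a) ⊓ B)) (a ⊓ (A ⊔ (A ⊔ a) ⊓ E)) x)
    (hw : IsComplIn ((A ⊔ a) ⊓ B ⊔ A ⊓ E) ((A ⊔ a) ⊓ E) w) : Persp x w := by
  have hA : ∀ C, A ⊔ a ⊓ (A ⊔ (A ⊔ a) ⊓ C) = A ⊔ (A ⊔ a) ⊓ C := by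
    intro C
    rw [← sup_inf_assoc_of_le _ le_sup_left]
    exact inf_eq_right.2 (sup_le le_sup_left inf_le_left)
  have hxa : x ≤ a := (le_sup_right.trans hx.2.le).trans inf_le_left
  have hwt : w ≤ (A ⊔ a) ⊓ E := le_sup_right.trans hw.2.le
  refine ⟨A ⊔ (A ⊔ a) ⊓ B, ?_, ?_, ?_⟩
  · rw [eq_bot_iff, ← hx.1]
    exact le_inf (le_inf (inf_le_left.trans hxa) inf_le_right) inf_le_left
  · have h : (A ⊔ a) ⊓ E ⊓ (A ⊔ (A ⊔ a) ⊓ B) = (A ⊔ a) ⊓ B ⊔ A ⊓ E := by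
      rw [← inf_sup_assoc_of_le A (inf_le_inf_left (A ⊔ a) hB), inf_right_comm,
        inf_eq_right.2 (le_sup_left : A ≤ A ⊔ a), sup_comm]
    rw [eq_bot_iff, ← hw.1, ← h]
    exact le_inf (le_inf (inf_le_left.trans hwt) inf_le_right) inf_le_left
  · have h₁ : x ⊔ (A ⊔ (A ⊔ a) ⊓ B) = A ⊔ (A ⊔ a) ⊓ E := by
      rw [← hA B, sup_left_comm, sup_comm x, hx.2, hA]
    have h₂ : w ⊔ (A ⊔ (A ⊔ a) ⊓ B) = A ⊔ (A ⊔ a) ⊓ E := by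
      rw [← hw.2]
      apply le_antisymm
      · exact sup_le (le_sup_right.trans le_sup_right)
          (sup_le_sup_left (le_sup_left.trans le_sup_left) _)
      · exact sup_le (le_sup_left.trans le_sup_right)
          (sup_le (sup_le (le_sup_right.trans le_sup_right)
            (inf_le_left.trans (le_sup_left.trans le_sup_right))) le_sup_left)
    rw [h₁, h₂]

theorem statement19
    (hcc : ∀ s : Set L, s.Nonempty → BddAbove s → ∃ m : L, IsLUB s m)
    (hmod : ∀ x y z : L, z ≤ x → x ⊓ (y ⊔ z) = (x ⊓ y) ⊔ z)
    (hsc : ∀ a b : L, a ≤ b → ∃ x : L, a ⊓ x = ⊥ ∧ a ⊔ x = b)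
    (hmc : ∀ a : L, ∀ D : Set L, D.Nonempty → DirectedOn (· ≤ ·) D → BddAbove D →
      ∀ m : L, IsLUB D m → IsLUB ((fun d => a ⊓ d) '' D) (a ⊓ m))
    {I J : Type*} (a : I → L) (b : J → L)
    (ha : OrthFam a) (hb : OrthFam b)
    (m : L) (hma : IsLUB (Set.range a) m) (hmb : IsLUB (Set.range b) m) :
    ∃ x y : I → J → L,
      (∀ i : I, OrthFam (x i) ∧ IsLUB (Set.range (x i)) (a i)) ∧
      (∀ j : J, OrthFam (fun i => y i j) ∧
        IsLUB (Set.range fun i => y i j) (b j)) ∧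
      (∀ i : I, ∀ j : J, BiPersp (x i j) (y i j)) := by
  have : IsModularLattice L := ⟨fun {x} y {z} h => by
    rw [inf_comm, sup_comm, hmod z y x h, sup_comm x, inf_comm y]⟩
  have hsup : ∀ s : Set L, BddAbove s → ∃ u, IsLUB s u := by
    intro s hs
    rcases s.eq_empty_or_nonempty with rfl | hne
    · exact ⟨⊥, isLUB_empty⟩
    · exact hcc s hne hs
  let _ : LinearOrder I := IsWellOrder.linearOrder WellOrderingRel
  have : WellFoundedLT I := ⟨(inferInstance : IsWellFounded I WellOrderingRel).wf⟩
  let _ : LinearOrder J := IsWellOrder.linearOrder WellOrderingRel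
  have : WellFoundedLT J := ⟨(inferInstance : IsWellFounded J WellOrderingRel).wf⟩
  choose A hA using fun i => hsup (a '' Set.Iio i) (ha.1.mono (Set.image_subset_range _ _))
  choose B hB using fun j => hsup (b '' Set.Iio j) (hb.1.mono (Set.image_subset_range _ _))
  choose x hx using fun i j => hsc (a i ⊓ (A i ⊔ (A i ⊔ a i) ⊓ B j))
    (a i ⊓ (A i ⊔ (A i ⊔ a i) ⊓ (B j ⊔ b j)))
    (inf_le_inf_left _ (sup_le_sup_left (inf_le_inf_left _ le_sup_left) _))
  choose y hy using fun i j => hsc (b j ⊓ (B j ⊔ (B j ⊔ b j) ⊓ A i))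
    (b j ⊓ (B j ⊔ (B j ⊔ b j) ⊓ (A i ⊔ a i)))
    (inf_le_inf_left _ (sup_le_sup_left (inf_le_inf_left _ le_sup_left) _))
  refine ⟨x, y, fun i => ?_, fun j => ?_, fun i j => ?_⟩
  · exact orthFam_refine hmc hB hmb (ha.inf_eq_bot hmc Set.self_notMem_Iio (hA i))
      (sup_le ((hA i).mono hma (Set.image_subset_range _ _)) (hma.1 ⟨i, rfl⟩)) (hx i)
  · exact orthFam_refine hmc hA hma (hb.inf_eq_bot hmc Set.self_notMem_Iio (hB j))
      (sup_le ((hB j).mono hmb (Set.image_subset_range _ _)) (hmb.1 ⟨j, rfl⟩)) fun i => hy i j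
  · obtain ⟨w, hw⟩ := hsc ((A i ⊔ a i) ⊓ B j ⊔ A i ⊓ (B j ⊔ b j)) ((A i ⊔ a i) ⊓ (B j ⊔ b j))
      (sup_le (inf_le_inf_left _ le_sup_left) (inf_le_inf_right _ le_sup_left))
    refine ⟨w, persp_refine le_sup_left (hx i j) hw,
      (persp_refine le_sup_left (hy i j) ?_).symm⟩
    rwa [IsComplIn, sup_comm ((B j ⊔ b j) ⊓ A i), inf_comm (B j ⊔ b j), inf_comm (B j),
      inf_comm (B j ⊔ b j)]

end PaperEsp
end
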